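/- Let P be a full-support joint distribution on Ω and let C_1, …, C_r, F_i, R_i, Q be as in the chain junction construction. Suppose additionally that for each i with 2 ≤ i ≤ r, under P the coordinates in R_i are conditionally independent of the coordinates in (C_1 ∪ … ∪ C_{i−1}) \ F_i given the coordinates in F_i, i.e., P[R_i | C_1 ∪ … ∪ C_{i−1}] = P[R_i | F_i] wherever defined. Then Q = P; that is, the chain junction factorization recovers the joint distribution exactly when the corresponding Markov conditional independencies hold. -/

import Mathlib

open scoped BigOperators

namespace CausalPre

variable {ι : Type*} [Fintype ι] [DecidableEq ι]
variable {F : ι → Type*} [∀ i, Fintype (F i)] [∀ i, DecidableEq (F i)]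
  [∀ i, Nonempty (F i)]

/-- Restriction of a full configuration to the coordinates in `S`. -/
def restrict (S : Finset ι) (x : ∀ i, F i) : ∀ i : S, F i := fun i => x i

/-- `P` is a joint distribution on `Ω = Π i, F i`. -/
def IsJoint (P : (∀ i, F i) → ℝ) : Prop :=
  (∀ x, 0 ≤ P x) ∧ ∑ x, P x = 1

/-- `P` has full support. -/
def FullSupport (P : (∀ i, F i) → ℝ) : Prop := ∀ x, 0 < P x

/-- Marginal of `P` on the coordinates in `S`. -/
noncomputable def marginal (P : (∀ i, F i) → ℝ) (S : Finset ι)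
    (s : ∀ i : S, F i) : ℝ :=
  ∑ x : ∀ i, F i, if restrict S x = s then P x else 0

/-- Conditional probability `P[T | S]`, evaluated at the restrictions of a full
configuration `x`:  `P[T | S](x_T | x_S) = P_{S ∪ T}(x_{S ∪ T}) / P_S(x_S)`. -/
noncomputable def condProb (P : (∀ i, F i) → ℝ) (T S : Finset ι)
    (x : ∀ i, F i) : ℝ :=
  marginal P (S ∪ T) (restrict (S ∪ T) x) / marginal P S (restrict S x)

/-- Entropy of the marginal of `P` on `S`. -/
noncomputable def entropy (P : (∀ i, F i) → ℝ) (S : Finset ι) : ℝ :=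
  -∑ s : ∀ i : S, F i, marginal P S s * Real.log (marginal P S s)

/-- Mutual information `I(S ; T)` of disjoint `S`, `T`. -/
noncomputable def mutualInfo (P : (∀ i, F i) → ℝ) (S T : Finset ι) : ℝ :=
  entropy P S + entropy P T - entropy P (S ∪ T)

/-- Conditional entropy `H(S | T)` for disjoint `S`, `T`. -/
noncomputable def condEntropy (P : (∀ i, F i) → ℝ) (S T : Finset ι) : ℝ :=
  entropy P (S ∪ T) - entropy P T

/-- Conditional mutual information `I(S ; T | U)` of pairwise disjoint `S`, `T`, `U`. -/
noncomputable def condMutualInfo (P : (∀ i, F i) → ℝ) (S T U : Finset ι) : ℝ :=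
  entropy P (S ∪ U) + entropy P (T ∪ U) - entropy P (S ∪ T ∪ U) - entropy P U

/-- Kullback–Leibler divergence `D_KL(P ‖ Q) = Σ_{x : P(x) > 0} P(x) log (P(x)/Q(x))`. -/
noncomputable def klDiv (P Q : (∀ i, F i) → ℝ) : ℝ :=
  ∑ x, if 0 < P x then P x * Real.log (P x / Q x) else 0

variable {r : ℕ}

/-- Union of the preceding cliques: `C_0 ∪ … ∪ C_{i-1}`. -/
def prevUnion (C : Fin (r + 1) → Finset ι) (i : Fin (r + 1)) : Finset ι :=
  (Finset.univ.filter (fun j => j < i)).sup C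

/-- Separator `F_i = C_i ∩ (C_0 ∪ … ∪ C_{i-1})`. -/
def sepSet (C : Fin (r + 1) → Finset ι) (i : Fin (r + 1)) : Finset ι :=
  C i ∩ prevUnion C i

/-- Residual `R_i = C_i \ F_i`. -/
def resSet (C : Fin (r + 1) → Finset ι) (i : Fin (r + 1)) : Finset ι :=
  C i \ sepSet C i

/-- The chain junction factorization
`Q(x) = P_{C_0}(x_{C_0}) · Π_{i ≠ 0} P[R_i | F_i](x_{R_i} | x_{F_i})`. -/
noncomputable def chainQ (P : (∀ i, F i) → ℝ) (C : Fin (r + 1) → Finset ι)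
    (x : ∀ i, F i) : ℝ :=
  marginal P (C 0) (restrict (C 0) x) *
    ∏ i ∈ Finset.univ.filter (fun j : Fin (r + 1) => j ≠ 0),
      condProb P (resSet C i) (sepSet C i) x

omit [∀ i, Nonempty (F i)] in
/-- A marginal of a full-support function is positive at the restriction of a configuration. -/
theorem marginal_restrict_pos {P : (∀ i, F i) → ℝ} (hfull : FullSupport P) (S : Finset ι)
    (x : ∀ i, F i) : 0 < marginal P S (restrict S x) := by
  refine Finset.sum_pos' (fun y _ => ?_) ⟨x, Finset.mem_univ x, ?_⟩
  · split_ifs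
    exacts [(hfull y).le, le_rfl]
  · simpa using hfull x

omit [∀ i, Nonempty (F i)] in
/-- The marginal on all coordinates is the function itself. -/
theorem marginal_univ_restrict (P : (∀ i, F i) → ℝ) (x : ∀ i, F i) :
    marginal P Finset.univ (restrict Finset.univ x) = P x := by
  have h (y : ∀ i, F i) :
      restrict (Finset.univ : Finset ι) y = restrict Finset.univ x ↔ y = x :=
    ⟨fun hy => funext fun i => congrFun hy ⟨i, Finset.mem_univ i⟩, fun hy => hy ▸ rfl⟩
  simp [marginal, h]

/-- The union of the first `n` cliques. -/
def initUnion (C : Fin (r + 1) → Finset ι) (n : ℕ) : Finset ι :=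
  (Finset.univ.filter (fun j : Fin (r + 1) => (j : ℕ) < n)).sup C

omit [Fintype ι] in
theorem mem_initUnion {C : Fin (r + 1) → Finset ι} {n : ℕ} {a : ι} :
    a ∈ initUnion C n ↔ ∃ j : Fin (r + 1), (j : ℕ) < n ∧ a ∈ C j := by
  simp [initUnion, Finset.mem_sup]

omit [Fintype ι] in
theorem initUnion_one (C : Fin (r + 1) → Finset ι) : initUnion C 1 = C 0 := by
  ext a
  simp [mem_initUnion]

omit [Fintype ι] in
theorem initUnion_full (C : Fin (r + 1) → Finset ι) :
    initUnion C (r + 1) = Finset.univ.sup C := by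
  ext a
  simp [mem_initUnion, Finset.mem_sup, -Order.lt_add_one_iff]

omit [Fintype ι] in
theorem prevUnion_eq_initUnion (C : Fin (r + 1) → Finset ι) (i : Fin (r + 1)) :
    prevUnion C i = initUnion C i := rfl

omit [Fintype ι] in
theorem initUnion_union_resSet (C : Fin (r + 1) → Finset ι) (i : Fin (r + 1)) :
    initUnion C i ∪ resSet C i = initUnion C (i + 1) := by
  have hres : initUnion C i ∪ resSet C i = initUnion C i ∪ C i := by
    ext a
    simp only [resSet, sepSet, prevUnion_eq_initUnion, Finset.mem_union, Finset.mem_sdiff,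
      Finset.mem_inter]
    tauto
  rw [hres]
  ext a
  simp only [Finset.mem_union, mem_initUnion, Nat.lt_succ_iff_lt_or_eq, or_and_right, exists_or,
    ← Fin.ext_iff, exists_eq_left]

/-- Telescoping product of successive quotients of a nowhere vanishing sequence. -/
theorem mul_prod_range_div_succ {K : Type*} [Field K] (g : ℕ → K) (hg : ∀ n, g n ≠ 0) (n : ℕ) :
    g 0 * ∏ k ∈ Finset.range n, g (k + 1) / g k = g n := by
  induction n with
  | zero => simp
  | succ n ih => rw [Finset.prod_range_succ, ← mul_assoc, ih, mul_div_cancel₀ _ (hg n)]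

/-- In the chain junction construction, if moreover for every
`i ≠ 0` the coordinates in `R_i` are conditionally independent (under `P`) of
the coordinates in `(C_0 ∪ … ∪ C_{i-1}) \ F_i` given those in `F_i`, i.e.
`P[R_i | C_0 ∪ … ∪ C_{i-1}] = P[R_i | F_i]`, then the factorization is exact:
`Q = P`. -/
theorem chainQ_eq_of_markov
    (P : (∀ i, F i) → ℝ) (hP : IsJoint P) (hfull : FullSupport P)
    (C : Fin (r + 1) → Finset ι)
    (hcov : Finset.univ.sup C = (Finset.univ : Finset ι))
    (hsep : ∀ i : Fin (r + 1), i ≠ 0 → sepSet C i ⊆ C (i - 1))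
    (hdisj : ∀ i j : Fin (r + 1), i ≠ j →
      Disjoint (if i = 0 then C 0 else resSet C i)
        (if j = 0 then C 0 else resSet C j))
    (hmarkov : ∀ i : Fin (r + 1), i ≠ 0 → ∀ x : ∀ i, F i,
      condProb P (resSet C i) (prevUnion C i) x
        = condProb P (resSet C i) (sepSet C i) x) :
    chainQ P C = P := by
  funext x
  let g : ℕ → ℝ := fun n =>
    marginal P (initUnion C (n + 1)) (restrict (initUnion C (n + 1)) x)
  have hcond (k : Fin r) :
      condProb P (resSet C k.succ) (sepSet C k.succ) x = g (k + 1) / g k := by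
    rw [← hmarkov k.succ (Fin.succ_ne_zero k) x, condProb, prevUnion_eq_initUnion,
      initUnion_union_resSet]
    rfl
  have hprod : ∏ i ∈ Finset.univ.filter (fun j : Fin (r + 1) => j ≠ 0),
      condProb P (resSet C i) (sepSet C i) x = ∏ k ∈ Finset.range r, g (k + 1) / g k := by
    rw [Finset.prod_filter, Fin.prod_univ_succ, Finset.prod_range]
    simp [hcond]
  have hzero : marginal P (C 0) (restrict (C 0) x) = g 0 := by
    change _ = marginal P (initUnion C 1) (restrict (initUnion C 1) x)
    rw [initUnion_one]
  have hlast : g r = P x := by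
    change marginal P (initUnion C (r + 1)) (restrict (initUnion C (r + 1)) x) = P x
    rw [initUnion_full, hcov, marginal_univ_restrict]
  rw [chainQ, hprod, hzero,
    mul_prod_range_div_succ g (fun n => (marginal_restrict_pos hfull _ x).ne'), hlast]

end CausalPre
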